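/- Suppose M is a positroid on [n] which is the direct sum M_1 ⊕ M_2 of two connected positroids M_1 and M_2 on nonempty ground sets E_1 and E_2 with E_1 ∪ E_2 = [n] and E_1 ∩ E_2 = ∅. Then E_1 and E_2 are cyclic intervals of [n]. -/

import Mathlib

open Finset

/-- A full-row-rank real `d × n` matrix is *totally nonnegative* if all of its
maximal (`d × d`) minors are nonnegative.  Columns are indexed by a finite
linearly ordered set `E`; a maximal minor is indexed by a strictly increasing
choice of `d` columns. -/
def Matrix.TotallyNonneg {d : ℕ} {E : Type*} [Fintype E] [LinearOrder E]
    (A : Matrix (Fin d) E ℝ) : Prop :=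
  A.rank = d ∧ ∀ f : Fin d → E, StrictMono f → 0 ≤ (A.submatrix id f).det

/-- `ℬ` is the collection of bases of the column matroid `M(A)`: the `d`-element
sets of column indices whose columns are linearly independent. -/
def Matrix.RepresentsBases {d : ℕ} {E : Type*} [Fintype E]
    (A : Matrix (Fin d) E ℝ) (ℬ : Finset E → Prop) : Prop :=
  ∀ B : Finset E, ℬ B ↔ B.card = d ∧ LinearIndependent ℝ (fun j : B => fun i => A i j.1)

/-- A positroid of rank `d` on the finite linearly ordered ground set `E`,
given by its collection of bases `ℬ`. -/
def IsPositroidOfRank (d : ℕ) {E : Type*} [Fintype E] [LinearOrder E]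
    (ℬ : Finset E → Prop) : Prop :=
  ∃ A : Matrix (Fin d) E ℝ, A.TotallyNonneg ∧ A.RepresentsBases ℬ

/-- A positroid on the finite linearly ordered ground set `E`. -/
def IsPositroid {E : Type*} [Fintype E] [LinearOrder E] (ℬ : Finset E → Prop) : Prop :=
  ∃ d, IsPositroidOfRank d ℬ


/-- The basis-exchange axiom: `ℬ` is the (nonempty) collection of bases of a
matroid on the ground set `E`. -/
def IsBasesSet {E : Type*} [DecidableEq E] (ℬ : Finset E → Prop) : Prop :=
  (∃ B, ℬ B) ∧
  ∀ ⦃B₁ B₂ : Finset E⦄, ℬ B₁ → ℬ B₂ → ∀ b₁ ∈ B₁ \ B₂,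
    ∃ b₂ ∈ B₂ \ B₁, ℬ (insert b₂ (B₁.erase b₁))

/-- Lexicographic order on two `d`-element subsets of `Fin n` (with respect to
the standard order): comparing the increasing enumerations `s_1 < ... < s_d`
and `t_1 < ... < t_d`, either they agree or they first differ at an index `k`
where `s_k < t_k`. -/
def LexLE {n : ℕ} (d : ℕ) (S T : Finset (Fin n)) : Prop :=
  ∃ (hS : S.card = d) (hT : T.card = d),
    S = T ∨ ∃ k : Fin d,
      (∀ l, l < k → ((S.orderIsoOfFin hS) l : Fin n) = ((T.orderIsoOfFin hT) l : Fin n)) ∧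
      ((S.orderIsoOfFin hS) k : Fin n) < ((T.orderIsoOfFin hT) k : Fin n)

/-- Gale order on two `d`-element subsets of `Fin n` (with respect to the
standard order): the increasing enumerations satisfy `s_k ≤ t_k` for all `k`. -/
def GaleLE {n : ℕ} (d : ℕ) (S T : Finset (Fin n)) : Prop :=
  ∃ (hS : S.card = d) (hT : T.card = d),
    ∀ k : Fin d, ((S.orderIsoOfFin hS) k : Fin n) ≤ ((T.orderIsoOfFin hT) k : Fin n)

/-- Transfer of a basis collection supported on a subset `S ⊆ Fin n` to a basis
collection on the ground set `S` itself (a subtype carrying the inherited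
order). -/
def toSubtypePred {n : ℕ} (S : Finset (Fin n)) (ℬ : Finset (Fin n) → Prop) :
    Finset {x : Fin n // x ∈ S} → Prop :=
  fun C => ℬ (C.map (Function.Embedding.subtype fun x => x ∈ S))

/-- A matroid (given by its basis collection `ℬ` on the ground set `E`) is
*connected* if it cannot be written as the direct sum of two matroids on
nonempty ground sets. -/
def MatroidConnected {E : Type*} [Fintype E] [DecidableEq E] (ℬ : Finset E → Prop) : Prop :=
  ¬ ∃ (E₁ E₂ : Finset E) (ℬ₁ ℬ₂ : Finset E → Prop),
      E₁.Nonempty ∧ E₂.Nonempty ∧ Disjoint E₁ E₂ ∧ E₁ ∪ E₂ = Finset.univ ∧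
      IsBasesSet ℬ₁ ∧ IsBasesSet ℬ₂ ∧
      (∀ B, ℬ₁ B → B ⊆ E₁) ∧ (∀ B, ℬ₂ B → B ⊆ E₂) ∧
      (∀ B, ℬ B ↔ ∃ B₁ B₂, ℬ₁ B₁ ∧ ℬ₂ B₂ ∧ B = B₁ ∪ B₂)

/-- `a, b, c, d` are (distinct and) in cyclic order in `Fin m`. -/
def Cyc4 {m : ℕ} (a b c d : Fin m) : Prop :=
  0 < (b - a).val ∧ (b - a).val < (c - a).val ∧ (c - a).val < (d - a).val

/-- The closed cyclic interval `[i, j] = {i, i+1, ..., j}` (cyclically) in `Fin n`. -/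
def cycInt {n : ℕ} (i j : Fin n) : Finset (Fin n) :=
  Finset.univ.filter fun ℓ => (ℓ - i).val ≤ (j - i).val


namespace PosAux

lemma basesSet_of_positroid {E : Type*} [Fintype E] [LinearOrder E]
    {ℬ : Finset E → Prop} (h : IsPositroid ℬ) : IsBasesSet ℬ := by
  obtain ⟨d, A, ⟨hrk, -⟩, hrep⟩ := h
  let v : E → Fin d → ℝ := fun j i => A i j
  have hrep' : ∀ B : Finset E, ℬ B ↔ B.card = d ∧ LinearIndepOn ℝ v (B : Set E) := hrep
  refine ⟨?_, ?_⟩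
  · obtain ⟨b, -, -, hspan, hli⟩ :=
      exists_linearIndepOn_extension (K := ℝ) (v := v) (s := ∅) (t := Set.univ)
        (linearIndepOn_empty ℝ v) (Set.subset_univ _)
    classical
    refine ⟨b.toFinset, (hrep' _).2 ⟨?_, by simpa using hli⟩⟩
    have h1 : Submodule.span ℝ (v '' b) = Submodule.span ℝ (Set.range v) := by
      apply le_antisymm
      · exact Submodule.span_mono (Set.image_subset_range _ _)
      · rw [Submodule.span_le]; simpa using hspan
    have h2 := finrank_span_eq_card hli
    have h3 : Set.range (fun x : b => v x) = v '' b := by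
      ext; simp
    rw [h3, h1] at h2
    rw [Matrix.rank_eq_finrank_span_cols] at hrk
    have h4 : (Set.range A.col) = Set.range v := rfl
    rw [h4, h2] at hrk
    rw [← hrk, Set.toFinset_card]
  · intro B₁ B₂ h₁ h₂ b₁ hb₁
    rw [hrep'] at h₁ h₂
    rw [Finset.mem_sdiff] at hb₁
    have hsplit : LinearIndepOn ℝ v (insert b₁ ((B₁.erase b₁ : Finset E) : Set E)) := by
      have : (insert b₁ ((B₁.erase b₁ : Finset E) : Set E)) = (B₁ : Set E) := by
        rw [← Finset.coe_insert, Finset.insert_erase hb₁.1]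
      rw [this]; exact h₁.2
    rw [linearIndepOn_insert (by simp)] at hsplit
    have hB2 : Submodule.span ℝ (v '' (B₂ : Set E)) = ⊤ := by
      have := h₂.2.span_eq_top_of_card_eq_finrank' (by simp [h₂.1])
      rw [← this]; congr 1; ext; simp
    have : ∃ b₂ ∈ B₂, v b₂ ∉ Submodule.span ℝ (v '' ((B₁.erase b₁ : Finset E) : Set E)) := by
      by_contra hcon
      push Not at hcon
      have : Submodule.span ℝ (v '' (B₂ : Set E)) ≤
          Submodule.span ℝ (v '' ((B₁.erase b₁ : Finset E) : Set E)) := by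
        rw [Submodule.span_le]
        rintro _ ⟨x, hx, rfl⟩
        exact hcon x hx
      rw [hB2] at this
      exact hsplit.2 (this trivial)
    obtain ⟨b₂, hb₂, hns⟩ := this
    have hnot : b₂ ∉ B₁.erase b₁ := fun hx =>
      hns (Submodule.subset_span ⟨b₂, by exact_mod_cast hx, rfl⟩)
    have hne : b₂ ≠ b₁ := by rintro rfl; exact hb₁.2 hb₂
    refine ⟨b₂, Finset.mem_sdiff.2 ⟨hb₂, fun hx => hnot (Finset.mem_erase.2 ⟨hne, hx⟩)⟩, ?_⟩
    rw [hrep']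
    refine ⟨?_, ?_⟩
    · rw [Finset.card_insert_of_notMem hnot, Finset.card_erase_add_one hb₁.1]; exact h₁.1
    · rw [Finset.coe_insert, linearIndepOn_insert (by exact_mod_cast hnot)]
      exact ⟨hsplit.1, hns⟩

/-- In a connected matroid every proper nonempty set is crossed by an exchange. -/
lemma exists_cross {E : Type*} [Fintype E] [DecidableEq E]
    {ℬ : Finset E → Prop} (hB : IsBasesSet ℬ) (hc : MatroidConnected ℬ)
    (X Y : Finset E) (hX : X.Nonempty) (hY : Y.Nonempty) (hXY : Disjoint X Y)
    (hU : X ∪ Y = Finset.univ) :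
    ∃ (S : Finset E) (a c : E), a ∈ X ∧ c ∈ Y ∧ a ∉ S ∧ c ∉ S ∧
      ℬ (insert a S) ∧ ℬ (insert c S) := by
  by_contra hcon
  push Not at hcon
  have mem : ∀ x, x ∈ X ∨ x ∈ Y := fun x => by
    rw [← Finset.mem_union, hU]; exact Finset.mem_univ x
  have nXY : ∀ x, x ∈ X → x ∈ Y → False := fun x h1 h2 => Finset.disjoint_left.1 hXY h1 h2
  -- exchange stays on one side
  have side : ∀ B b c, ℬ B → b ∈ B → c ∉ B → ℬ (insert c (B.erase b)) → (b ∈ X ↔ c ∈ X) := by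
    intro B b c h1 hb hcB h2
    have hb1 : b ∉ B.erase b := by simp
    have hc1 : c ∉ B.erase b := fun h => hcB (Finset.mem_of_mem_erase h)
    have h1' : ℬ (insert b (B.erase b)) := by rwa [Finset.insert_erase hb]
    constructor
    · intro hbX
      rcases mem c with h | h
      · exact h
      · exact absurd h2 (hcon _ b c hbX h hb1 hc1 h1')
    · intro hcX
      rcases mem b with h | h
      · exact h
      · exact absurd h1' (hcon _ c b hcX h hc1 hb1 h2)
  have mix : ∀ k : ℕ, ∀ B B', ℬ B → ℬ B' → ((B ∩ Y) \ B').card = k → ℬ ((B ∩ X) ∪ (B' ∩ Y)) := by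
    intro k
    induction k with
    | zero =>
      intro B B' h1 h2 hk
      rw [Finset.card_eq_zero, Finset.sdiff_eq_empty_iff_subset] at hk
      have : (B ∩ X) ∪ (B' ∩ Y) = B := by
        ext x
        simp only [Finset.mem_union, Finset.mem_inter]
        constructor
        · rintro (h | ⟨hx, hxY⟩)
          · exact h.1
          · by_contra hxB
            obtain ⟨y, hy, hy2⟩ := hB.2 h2 h1 x (Finset.mem_sdiff.2 ⟨hx, hxB⟩)
            rw [Finset.mem_sdiff] at hy
            have := side B' x y h2 hx hy.2 hy2
            rcases mem y with h | h
            · exact nXY x (this.2 h) hxY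
            · exact hy.2 (hk (Finset.mem_inter.2 ⟨hy.1, h⟩))
        · intro hx
          rcases mem x with h | h
          · exact Or.inl ⟨hx, h⟩
          · exact Or.inr ⟨hk (Finset.mem_inter.2 ⟨hx, h⟩), h⟩
      rw [this]; exact h1
    | succ k ih =>
      intro B B' h1 h2 hk
      obtain ⟨b, hb⟩ : ((B ∩ Y) \ B').Nonempty := by rw [← Finset.card_pos]; omega
      have hb' := hb
      rw [Finset.mem_sdiff, Finset.mem_inter] at hb'
      obtain ⟨⟨hbB, hbY⟩, hbB'⟩ := hb'
      obtain ⟨y, hy, hy2⟩ := hB.2 h1 h2 b (Finset.mem_sdiff.2 ⟨hbB, hbB'⟩)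
      rw [Finset.mem_sdiff] at hy
      have hs := side B b y h1 hbB hy.2 hy2
      have hbX : b ∉ X := fun h => nXY b h hbY
      have hyX : y ∉ X := fun h => hbX (hs.2 h)
      have hyY : y ∈ Y := (mem y).resolve_left hyX
      have e1 : (insert y (B.erase b)) ∩ X = B ∩ X := by
        ext x
        simp only [Finset.mem_inter, Finset.mem_insert, Finset.mem_erase]
        constructor
        · rintro ⟨rfl | h, hx⟩
          · exact absurd hx hyX
          · exact ⟨h.2, hx⟩
        · rintro ⟨h, hx⟩
          exact ⟨Or.inr ⟨by rintro rfl; exact hbX hx, h⟩, hx⟩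
      have e2 : ((insert y (B.erase b)) ∩ Y) \ B' = ((B ∩ Y) \ B').erase b := by
        ext x
        simp only [Finset.mem_inter, Finset.mem_insert, Finset.mem_erase, Finset.mem_sdiff]
        constructor
        · rintro ⟨⟨rfl | h, hx⟩, hx'⟩
          · exact absurd hy.1 hx'
          · exact ⟨h.1, ⟨h.2, hx⟩, hx'⟩
        · rintro ⟨h, ⟨h3, h4⟩, h5⟩
          exact ⟨⟨Or.inr ⟨h, h3⟩, h4⟩, h5⟩
      have := ih _ B' hy2 h2 (by rw [e2, Finset.card_erase_of_mem hb, hk]; rfl)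
      rwa [e1] at this
  have exch : ∀ Z : Finset E, (∀ B b c, ℬ B → b ∈ B → c ∉ B → ℬ (insert c (B.erase b)) →
      b ∈ Z → c ∈ Z) → IsBasesSet (fun U => ∃ B, ℬ B ∧ U = B ∩ Z) := by
    intro Z hZ
    refine ⟨?_, ?_⟩
    · obtain ⟨B, h⟩ := hB.1
      exact ⟨_, B, h, rfl⟩
    · rintro _ _ ⟨B1, h1, rfl⟩ ⟨B2, h2, rfl⟩ b hb
      rw [Finset.mem_sdiff, Finset.mem_inter, Finset.mem_inter] at hb
      obtain ⟨⟨hb1, hbZ⟩, hb2⟩ := hb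
      have hb2' : b ∉ B2 := fun h => hb2 ⟨h, hbZ⟩
      obtain ⟨y, hy, hy2⟩ := hB.2 h1 h2 b (Finset.mem_sdiff.2 ⟨hb1, hb2'⟩)
      rw [Finset.mem_sdiff] at hy
      have hyZ := hZ B1 b y h1 hb1 hy.2 hy2 hbZ
      refine ⟨y, by simp [hy, hyZ], _, hy2, ?_⟩
      ext x
      simp only [Finset.mem_inter, Finset.mem_insert, Finset.mem_erase]
      constructor
      · rintro (rfl | h)
        · exact ⟨Or.inl rfl, hyZ⟩
        · exact ⟨Or.inr ⟨h.1, h.2.1⟩, h.2.2⟩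
      · rintro ⟨rfl | h, hx⟩
        · exact Or.inl rfl
        · exact Or.inr ⟨h.1, h.2, hx⟩
  apply hc
  refine ⟨X, Y, fun U => ∃ B, ℬ B ∧ U = B ∩ X, fun U => ∃ B, ℬ B ∧ U = B ∩ Y, hX, hY, hXY, hU,
    exch X fun B b c h1 h2 h3 h4 h5 => (side B b c h1 h2 h3 h4).1 h5,
    exch Y fun B b c h1 h2 h3 h4 h5 => (mem c).resolve_left
      fun h => nXY b ((side B b c h1 h2 h3 h4).2 h) h5, ?_, ?_, ?_⟩
  · rintro _ ⟨B, -, rfl⟩; exact Finset.inter_subset_right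
  · rintro _ ⟨B, -, rfl⟩; exact Finset.inter_subset_right
  · intro B
    constructor
    · intro h
      refine ⟨_, _, ⟨B, h, rfl⟩, ⟨B, h, rfl⟩, ?_⟩
      rw [← Finset.inter_union_distrib_left, hU, Finset.inter_univ]
    · rintro ⟨_, _, ⟨B1, h1, rfl⟩, ⟨B2, h2, rfl⟩, rfl⟩
      exact mix _ B1 B2 h1 h2 rfl

lemma cross_fin {n : ℕ} {ℬ : Finset (Fin n) → Prop} {E : Finset (Fin n)}
    (hpos : IsPositroid (toSubtypePred E ℬ)) (hconn : MatroidConnected (toSubtypePred E ℬ))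
    (P : Fin n → Prop) {x y : Fin n} (hx : x ∈ E) (hy : y ∈ E) (hPx : P x) (hPy : ¬ P y) :
    ∃ (S : Finset (Fin n)) (a c : Fin n), S ⊆ E ∧ a ∈ E ∧ c ∈ E ∧ P a ∧ ¬ P c ∧ a ∉ S ∧ c ∉ S ∧
      ℬ (insert a S) ∧ ℬ (insert c S) := by
  classical
  obtain ⟨S, a, c, ha, hc, haS, hcS, h1, h2⟩ := exists_cross (basesSet_of_positroid hpos) hconn
    (Finset.univ.filter fun z => P z.1) (Finset.univ.filter fun z => ¬ P z.1)
    ⟨⟨x, hx⟩, by simpa using hPx⟩ ⟨⟨y, hy⟩, by simpa using hPy⟩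
    (Finset.disjoint_filter_filter_not _ _ _) (Finset.filter_union_filter_not_eq _ _)
  refine ⟨S.map (Function.Embedding.subtype fun x => x ∈ E), a, c, ?_, a.2, c.2,
    by simpa using ha, by simpa using hc, by simpa using haS, by simpa using hcS, ?_, ?_⟩
  · intro z hz
    simp only [Finset.mem_map] at hz
    obtain ⟨w, -, rfl⟩ := hz
    exact w.2
  · have := h1; unfold toSubtypePred at this; rwa [Finset.map_insert] at this
  · have := h2; unfold toSubtypePred at this; rwa [Finset.map_insert] at this

end PosAux

namespace PosAux

/-- Position at which `x` has to be inserted into an increasing sequence. -/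
lemma exists_pos {m n : ℕ} (s : Fin m → Fin n) (hs : StrictMono s) (x : Fin n) :
    ∃ k : Fin (m + 1), ∀ i : Fin m, s i < x ↔ i.castSucc < k := by
  by_cases h : ∃ i : Fin m, ¬ s i < x
  · classical
    obtain ⟨i, hi, hmin⟩ := WellFounded.has_min (wellFounded_lt (α := Fin m)) {i | ¬ s i < x} h
    refine ⟨i.castSucc, fun j => ?_⟩
    rw [Fin.castSucc_lt_castSucc_iff]
    constructor
    · intro hj
      by_contra hji
      exact hi (lt_of_le_of_lt (hs.monotone (not_lt.1 hji)) hj)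
    · intro hj
      by_contra hc
      exact hmin j hc hj
  · push Not at h
    exact ⟨Fin.last m, fun i => ⟨fun _ => Fin.castSucc_lt_last i, fun _ => h i⟩⟩

lemma strictMono_two {m n : ℕ} (s : Fin m → Fin n) (hs : StrictMono s) (x y : Fin n)
    (hx : ∀ i, s i ≠ x) (hy : ∀ i, s i ≠ y) (hxy : x < y) (k l : Fin (m + 1))
    (hk : ∀ i : Fin m, s i < x ↔ i.castSucc < k) (hl : ∀ i : Fin m, s i < y ↔ i.castSucc < l) :
    StrictMono (Fin.insertNth (α := fun _ => Fin n) l.succ y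
      (Fin.insertNth (α := fun _ => Fin n) k x s)) := by
  have hkl : k ≤ l := by
    by_contra hc
    push Not at hc
    have hlm : l.val < m := by have := k.2; have : l.val < k.val := hc; omega
    have h1 := (hk ⟨l.val, hlm⟩).2 hc
    have h2 := (hl ⟨l.val, hlm⟩).1 (h1.trans hxy)
    exact absurd h2 (lt_irrefl _)
  rw [Fin.strictMono_insertNth_iff]
  refine ⟨?_, ?_⟩
  · rw [Fin.strictMono_insertNth_iff]
    exact ⟨hs, fun i h => (hk i).2 h, fun i h =>
      lt_of_le_of_ne (not_lt.1 fun h' => absurd ((hk i).1 h') (not_lt.2 h)) (hx i).symm⟩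
  · have key : ∀ i : Fin (m + 1), i.castSucc < l.succ ↔
        (Fin.insertNth (α := fun _ => Fin n) k x s i) < y := by
      intro i
      cases i using Fin.succAboveCases k with
      | x => 
        simp only [Fin.insertNth_apply_same, hxy, iff_true]
        simp only [Fin.lt_def, Fin.le_def, Fin.val_castSucc, Fin.val_succ] at *; omega
      | p j =>
        simp only [Fin.insertNth_apply_succAbove]
        rw [hl j]
        have hj := hk j
        have hj2 := hl j
        by_cases hjk : j.castSucc < k
        · rw [Fin.succAbove_of_castSucc_lt _ _ hjk]
          simp only [Fin.lt_def, Fin.le_def, Fin.val_castSucc, Fin.val_succ] at *; omega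
        · rw [Fin.succAbove_of_le_castSucc _ _ (not_lt.1 hjk)]
          simp only [Fin.lt_def, Fin.le_def, Fin.val_castSucc, Fin.val_succ] at *; omega
    refine ⟨fun i h => (key i).1 h, fun i h => lt_of_le_of_ne
      (not_lt.1 fun h' => absurd ((key i).2 h') (not_lt.2 h)) ?_⟩
    cases i using Fin.succAboveCases k with
    | x => simpa using hxy.ne'
    | p j => simpa using (hy j).symm

lemma det_insertNth {m n : ℕ} (A : Matrix (Fin (m + 1)) (Fin n) ℝ) (k : Fin (m + 1)) (x : Fin n)
    (s : Fin m → Fin n) :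
    (A.submatrix id (Fin.insertNth (α := fun _ => Fin n) k x s)).det =
      (-1) ^ (k : ℕ) * (A.submatrix id (Fin.cons x s)).det := by
  rw [← Fin.cons_comp_cycleRange]
  have := Matrix.det_permute' k.cycleRange (A.submatrix id (Fin.cons x s))
  rw [Matrix.submatrix_submatrix] at this
  simpa [Function.comp_def] using this

lemma det_two {m n : ℕ} (A : Matrix (Fin (m + 2)) (Fin n) ℝ) (k l : Fin (m + 1)) (x y : Fin n)
    (s : Fin m → Fin n) :
    (A.submatrix id (Fin.insertNth (α := fun _ => Fin n) l.succ y
      (Fin.insertNth (α := fun _ => Fin n) k x s))).det =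
      (-1) ^ (k : ℕ) * (-1) ^ (l : ℕ) * (A.submatrix id (Fin.cons x (Fin.cons y s))).det := by
  rw [det_insertNth, ← Fin.insertNth_succ_cons, det_insertNth, Fin.val_succ, Fin.val_succ]
  ring

/-- The alternating form `(u, v) ↦ det (u, v, w)`. -/
noncomputable def om {m : ℕ} (w : Fin m → Fin (m + 2) → ℝ) (u v : Fin (m + 2) → ℝ) : ℝ :=
  Matrix.detRowAlternating (R := ℝ)
    (Fin.cons u (Fin.cons v w : Fin (m + 1) → Fin (m + 2) → ℝ) : Fin (m + 2) → Fin (m + 2) → ℝ)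

section
variable {m : ℕ} (w : Fin m → Fin (m + 2) → ℝ)

lemma om_self (u) : om w u u = 0 := by
  unfold om
  exact AlternatingMap.map_eq_zero_of_eq _ _ (i := 0) (j := 1) rfl (by simp)

lemma om_w (u) (k : Fin m) : om w u (w k) = 0 := by
  unfold om
  refine AlternatingMap.map_eq_zero_of_eq _ _ (i := 1) (j := k.succ.succ) rfl ?_
  simp [Fin.ext_iff]

lemma om_upd0 (u v u' : Fin (m + 2) → ℝ) : om w u v = Matrix.detRowAlternating (R := ℝ)
    (Function.update (Fin.cons u' (Fin.cons v w : Fin (m + 1) → Fin (m + 2) → ℝ) :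
      Fin (m + 2) → Fin (m + 2) → ℝ) 0 u) := by
  rw [Fin.update_cons_zero]; rfl

lemma om_upd1 (u v v' : Fin (m + 2) → ℝ) : om w u v = Matrix.detRowAlternating (R := ℝ)
    (Function.update (Fin.cons u (Fin.cons v' w : Fin (m + 1) → Fin (m + 2) → ℝ) :
      Fin (m + 2) → Fin (m + 2) → ℝ) 1 v) := by
  rw [show (1 : Fin (m + 2)) = Fin.succ 0 from rfl, ← Fin.cons_update, Fin.update_cons_zero]; rfl

lemma om_add_left (u u' v) : om w (u + u') v = om w u v + om w u' v := by
  rw [om_upd0 w _ v 0, om_upd0 w u v 0, om_upd0 w u' v 0, AlternatingMap.map_update_add]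

lemma om_smul_left (r : ℝ) (u v) : om w (r • u) v = r * om w u v := by
  rw [om_upd0 w _ v 0, om_upd0 w u v 0, AlternatingMap.map_update_smul, smul_eq_mul]

lemma om_add_right (u v v') : om w u (v + v') = om w u v + om w u v' := by
  rw [om_upd1 w u _ 0, om_upd1 w u v 0, om_upd1 w u v' 0, AlternatingMap.map_update_add]

lemma om_smul_right (r : ℝ) (u v) : om w u (r • v) = r * om w u v := by
  rw [om_upd1 w u _ 0, om_upd1 w u v 0, AlternatingMap.map_update_smul, smul_eq_mul]

lemma om_swap (u v) : om w v u = - om w u v := by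
  have := om_self w (u + v)
  rw [om_add_left, om_add_right, om_add_right, om_self, om_self] at this
  linarith

lemma om_sum (u) (c : Fin m → ℝ) : om w u (∑ k, c k • w k) = 0 := by
  have : ∀ t : Finset (Fin m), om w u (∑ k ∈ t, c k • w k) = 0 := by
    intro t
    induction t using Finset.induction_on with
    | empty =>
      have := om_smul_right w 0 u 0
      simpa using this
    | insert a t ha ih => rw [Finset.sum_insert ha, om_add_right, om_smul_right, om_w, ih]; simp
  exact this _

lemma om_ne_iff (u v) : om w u v ≠ 0 ↔ LinearIndependent ℝ
    (Fin.cons u (Fin.cons v w : Fin (m + 1) → Fin (m + 2) → ℝ) :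
      Fin (m + 2) → Fin (m + 2) → ℝ) := by
  have := Matrix.linearIndependent_rows_iff_isUnit (K := ℝ)
    (A := (Matrix.of (Fin.cons u (Fin.cons v w : Fin (m + 1) → Fin (m + 2) → ℝ) :
      Fin (m + 2) → Fin (m + 2) → ℝ)))
  rw [Matrix.isUnit_iff_isUnit_det, isUnit_iff_ne_zero] at this
  exact this.symm

lemma expand (a b c : Fin (m + 2) → ℝ) (h : om w a b ≠ 0) :
    ∃ (α β : ℝ) (z : Fin (m + 2) → ℝ), c = α • a + β • b + z ∧ ∀ u, om w u z = 0 := by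
  rw [om_ne_iff] at h
  have hs := h.span_eq_top_of_card_eq_finrank' (by simp)
  have hc : c ∈ Submodule.span ℝ (Set.range (Fin.cons a (Fin.cons b w :
      Fin (m + 1) → Fin (m + 2) → ℝ) : Fin (m + 2) → Fin (m + 2) → ℝ)) := by rw [hs]; trivial
  rw [Submodule.mem_span_range_iff_exists_fun] at hc
  obtain ⟨f, hf⟩ := hc
  refine ⟨f 0, f 1, ∑ k : Fin m, f k.succ.succ • w k, ?_, fun u => om_sum w u _⟩
  rw [← hf, Fin.sum_univ_succ, Fin.sum_univ_succ]
  simp [add_assoc]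

lemma no_cross_vec (a b c d : Fin (m + 2) → ℝ) (ea eb ec ed : ℝ)
    (hab : 0 ≤ ea * eb * om w a b) (hcd : 0 ≤ ec * ed * om w c d)
    (had : 0 ≤ ea * ed * om w a d) (hbc : 0 ≤ eb * ec * om w b c)
    (ha0 : ea ≠ 0) (hb0 : eb ≠ 0) (hc0 : ec ≠ 0) (hd0 : ed ≠ 0)
    (nab : om w a b ≠ 0) (ncd : om w c d ≠ 0) (hac : om w a c = 0) (hbd : om w b d = 0) :
    False := by
  obtain ⟨α, β, z, rfl, hz⟩ := expand w a b c nab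
  obtain ⟨γ, δ, y, rfl, hy⟩ := expand w a b d nab
  have hz' : ∀ u, om w z u = 0 := fun u => by rw [om_swap, hz, neg_zero]
  have hy' : ∀ u, om w y u = 0 := fun u => by rw [om_swap, hy, neg_zero]
  have hba := om_swap w a b
  simp only [om_add_left, om_add_right, om_smul_left, om_smul_right, om_self, hz, hy, hz', hy',
    hba] at *
  generalize om w a b = t at *
  have hβ : β = 0 := by
    have : β * t = 0 := by linarith
    exact (mul_eq_zero.1 this).resolve_right nab
  have hγ : γ = 0 := by
    have : γ * t = 0 := by linarith
    exact (mul_eq_zero.1 this).resolve_right nab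
  subst hβ hγ
  have h1 : 0 < ea * eb * t := lt_of_le_of_ne hab (by positivity)
  have h2 : 0 < ec * ed * (α * δ * t) := by
    refine lt_of_le_of_ne (by linarith) (Ne.symm ?_)
    refine mul_ne_zero (mul_ne_zero hc0 hd0) ?_
    intro h; apply ncd; linarith
  have h3 : 0 ≤ ea * ed * (δ * t) := by linarith
  have h4 : 0 ≤ - (eb * ec * (α * t)) := by linarith
  have h5 := mul_pos h1 h2
  have h6 := mul_nonneg h3 h4
  have : ea * ed * (δ * t) * - (eb * ec * (α * t)) = -(ea * eb * t * (ec * ed * (α * δ * t))) := by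
    ring
  linarith

end

lemma no_cross_pos {n : ℕ} {ℬ : Finset (Fin n) → Prop} (hpos : IsPositroid ℬ)
    (S : Finset (Fin n)) {a b c d : Fin n} (ha : a ∉ S) (hb : b ∉ S) (hc : c ∉ S) (hd : d ∉ S)
    (h1 : a < b) (h2 : b < c) (h3 : c < d)
    (hab : ℬ (insert a (insert b S))) (hcd : ℬ (insert c (insert d S)))
    (hac : ¬ ℬ (insert a (insert c S))) (hbd : ¬ ℬ (insert b (insert d S))) : False := by
  obtain ⟨D, A, ⟨-, htn⟩, hrep⟩ := hpos
  have hD : D = S.card + 2 := by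
    rw [← ((hrep _).1 hab).1, Finset.card_insert_of_notMem, Finset.card_insert_of_notMem hb]
    simp [ha, h1.ne]
  subst hD
  let s : Fin S.card → Fin n := fun i => S.orderEmbOfFin rfl i
  have hsm : StrictMono s := (S.orderEmbOfFin rfl).strictMono
  have hsr : Set.range s = S := S.range_orderEmbOfFin rfl
  have hns : ∀ x, x ∉ S → ∀ i, s i ≠ x := by
    rintro x hx i rfl
    exact hx (S.orderEmbOfFin_mem rfl i)
  let v : Fin n → Fin (S.card + 2) → ℝ := fun j i => A i j
  choose k hk using fun x => exists_pos s hsm x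
  let e : Fin n → ℝ := fun x => (-1) ^ (k x : ℕ)
  have he : ∀ x, e x ≠ 0 := fun x => by simp [e]
  have hom : ∀ x y, om (v ∘ s) (v x) (v y) = (A.submatrix id (Fin.cons x (Fin.cons y s))).det := by
    intro x y
    rw [← Matrix.det_transpose]
    unfold om
    change Matrix.det _ = Matrix.det _
    congr 1
    ext i j
    refine Fin.cases ?_ (fun i => Fin.cases ?_ (fun i => ?_) i) i <;> rfl
  have hnn : ∀ x y, x ∉ S → y ∉ S → x < y → 0 ≤ e x * e y * om (v ∘ s) (v x) (v y) := by
    intro x y hx hy hxy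
    rw [hom, ← det_two]
    exact htn _ (strictMono_two s hsm x y (hns x hx) (hns y hy) hxy _ _ (hk x) (hk y))
  have hbas : ∀ x y, x ∉ S → y ∉ S → x < y →
      (ℬ (insert x (insert y S)) ↔ om (v ∘ s) (v x) (v y) ≠ 0) := by
    intro x y hx hy hxy
    have hcard : (insert x (insert y S)).card = S.card + 2 := by
      rw [Finset.card_insert_of_notMem, Finset.card_insert_of_notMem hy]
      simp [hx, hxy.ne]
    rw [hrep _, om_ne_iff]
    have hinj : Function.Injective (Fin.cons x (Fin.cons y s : Fin (S.card + 1) → Fin n) :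
        Fin (S.card + 2) → Fin n) := by
      rw [Fin.cons_injective_iff, Fin.cons_injective_iff, Fin.range_cons, hsr]
      refine ⟨?_, ?_, hsm.injective⟩
      · simp [hx, hxy.ne]
      · simpa using hy
    have hr : Set.range (Fin.cons x (Fin.cons y s : Fin (S.card + 1) → Fin n) :
        Fin (S.card + 2) → Fin n) = (insert x (insert y S) : Finset (Fin n)) := by
      rw [Fin.range_cons, Fin.range_cons, hsr]; simp
    have h := linearIndepOn_range_iff (R := ℝ) hinj v
    rw [hr] at h
    have hv : v ∘ (Fin.cons x (Fin.cons y s : Fin (S.card + 1) → Fin n) :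
        Fin (S.card + 2) → Fin n) = (Fin.cons (v x) (Fin.cons (v y) (v ∘ s) :
        Fin (S.card + 1) → Fin (S.card + 2) → ℝ)) := by
      funext i
      refine Fin.cases ?_ (fun i => Fin.cases ?_ (fun i => ?_) i) i <;> rfl
    rw [hv] at h
    rw [← h]
    exact ⟨fun h => h.2, fun h => ⟨hcard, h⟩⟩
  rw [hbas a b ha hb h1] at hab
  rw [hbas c d hc hd h3] at hcd
  rw [hbas a c ha hc (h1.trans h2), not_not] at hac
  rw [hbas b d hb hd (h2.trans h3), not_not] at hbd
  exact no_cross_vec (v ∘ s) (v a) (v b) (v c) (v d) (e a) (e b) (e c) (e d)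
    (hnn a b ha hb h1) (hnn c d hc hd h3) (hnn a d ha hd (h1.trans (h2.trans h3)))
    (hnn b c hb hc h2) (he a) (he b) (he c) (he d) hab hcd hac hbd

end PosAux

namespace PosAux

lemma no_cross_sum {n : ℕ} {ℬ ℬ₁ ℬ₂ : Finset (Fin n) → Prop}
    {E₁ E₂ : Finset (Fin n)}
    (hdisj : Disjoint E₁ E₂)
    (hsupp₁ : ∀ B, ℬ₁ B → B ⊆ E₁) (hsupp₂ : ∀ B, ℬ₂ B → B ⊆ E₂)
    (hsum : ∀ B, ℬ B ↔ ∃ B₁ B₂, ℬ₁ B₁ ∧ ℬ₂ B₂ ∧ B = B₁ ∪ B₂)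
    (hpos : IsPositroid ℬ) (S T : Finset (Fin n)) {a b c d : Fin n}
    (haS : a ∉ S) (hcS : c ∉ S) (hbT : b ∉ T) (hdT : d ∉ T)
    (ha : ℬ₁ (insert a S)) (hc : ℬ₁ (insert c S)) (hb : ℬ₂ (insert b T)) (hd : ℬ₂ (insert d T))
    (h1 : a < b) (h2 : b < c) (h3 : c < d) : False := by
  have hcard : ∃ D, ∀ B, ℬ B → B.card = D := by
    obtain ⟨D, A, -, hrep⟩ := hpos
    exact ⟨D, fun B h => ((hrep B).1 h).1⟩
  obtain ⟨D, hD⟩ := hcard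
  have nd : ∀ x, x ∈ E₁ → x ∈ E₂ → False := fun x h h' => Finset.disjoint_left.1 hdisj h h'
  have sa := hsupp₁ _ ha
  have sc := hsupp₁ _ hc
  have sb := hsupp₂ _ hb
  have sd := hsupp₂ _ hd
  have haE : a ∈ E₁ := sa (Finset.mem_insert_self _ _)
  have hcE : c ∈ E₁ := sc (Finset.mem_insert_self _ _)
  have hbE : b ∈ E₂ := sb (Finset.mem_insert_self _ _)
  have hdE : d ∈ E₂ := sd (Finset.mem_insert_self _ _)
  have hSE : S ⊆ E₁ := (Finset.subset_insert _ _).trans sa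
  have hTE : T ⊆ E₂ := (Finset.subset_insert _ _).trans sb
  -- cardinalities
  have c1 : ∀ B₁ B₂, ℬ₁ B₁ → ℬ₂ B₂ → B₁.card + B₂.card = D := by
    intro B₁ B₂ h h'
    rw [← hD (B₁ ∪ B₂) ((hsum _).2 ⟨_, _, h, h', rfl⟩), Finset.card_union_of_disjoint]
    exact Finset.disjoint_of_subset_left (hsupp₁ _ h) (Finset.disjoint_of_subset_right (hsupp₂ _ h') hdisj)
  have c0 := c1 _ _ ha hb
  rw [Finset.card_insert_of_notMem haS, Finset.card_insert_of_notMem hbT] at c0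
  refine no_cross_pos hpos (S ∪ T) (a := a) (b := b) (c := c) (d := d) ?_ ?_ ?_ ?_ h1 h2 h3 ?_ ?_ ?_ ?_
  · rw [Finset.mem_union]; rintro (h | h)
    · exact haS h
    · exact nd _ haE (hTE h)
  · rw [Finset.mem_union]; rintro (h | h)
    · exact nd _ (hSE h) hbE
    · exact hbT h
  · rw [Finset.mem_union]; rintro (h | h)
    · exact hcS h
    · exact nd _ hcE (hTE h)
  · rw [Finset.mem_union]; rintro (h | h)
    · exact nd _ (hSE h) hdE
    · exact hdT h
  · refine (hsum _).2 ⟨_, _, ha, hb, ?_⟩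
    ext x; simp only [Finset.mem_insert, Finset.mem_union]; tauto
  · refine (hsum _).2 ⟨_, _, hc, hd, ?_⟩
    ext x; simp only [Finset.mem_insert, Finset.mem_union]; tauto
  · rw [hsum]
    rintro ⟨B₁, B₂, hB₁, hB₂, he⟩
    have hT : B₂ = T := by
      ext x
      have hx : x ∈ insert a (insert c (S ∪ T)) ↔ x ∈ B₁ ∪ B₂ := by rw [he]
      simp only [Finset.mem_insert, Finset.mem_union] at hx
      constructor
      · intro h
        have hxE := hsupp₂ _ hB₂ h
        rcases hx.2 (Or.inr h) with rfl | rfl | h | h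
        · exact (nd _ haE hxE).elim
        · exact (nd _ hcE hxE).elim
        · exact (nd _ (hSE h) hxE).elim
        · exact h
      · intro h
        rcases hx.1 (by tauto) with h' | h'
        · exact (nd _ (hsupp₁ _ hB₁ h') (hTE h)).elim
        · exact h'
    have := c1 _ _ ha hB₂
    rw [hT, Finset.card_insert_of_notMem haS] at this
    omega
  · rw [hsum]
    rintro ⟨B₁, B₂, hB₁, hB₂, he⟩
    have hT : B₁ = S := by
      ext x
      have hx : x ∈ insert b (insert d (S ∪ T)) ↔ x ∈ B₁ ∪ B₂ := by rw [he]
      simp only [Finset.mem_insert, Finset.mem_union] at hx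
      constructor
      · intro h
        have hxE := hsupp₁ _ hB₁ h
        rcases hx.2 (Or.inl h) with rfl | rfl | h | h
        · exact (nd _ hxE hbE).elim
        · exact (nd _ hxE hdE).elim
        · exact h
        · exact (nd _ hxE (hTE h)).elim
      · intro h
        rcases hx.1 (by tauto) with h' | h'
        · exact h'
        · exact (nd _ (hSE h) (hsupp₂ _ hB₂ h')).elim
    have := c1 _ _ hB₁ hb
    rw [hT, Finset.card_insert_of_notMem hbT] at this
    omega

lemma no_alt {n : ℕ} {ℬ ℬ₁ ℬ₂ : Finset (Fin n) → Prop}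
    {E₁ E₂ : Finset (Fin n)}
    (hdisj : Disjoint E₁ E₂)
    (hsupp₁ : ∀ B, ℬ₁ B → B ⊆ E₁) (hsupp₂ : ∀ B, ℬ₂ B → B ⊆ E₂)
    (hsum : ∀ B, ℬ B ↔ ∃ B₁ B₂, ℬ₁ B₁ ∧ ℬ₂ B₂ ∧ B = B₁ ∪ B₂)
    (hpos : IsPositroid ℬ)
    (hpos₁ : IsPositroid (toSubtypePred E₁ ℬ₁)) (hpos₂ : IsPositroid (toSubtypePred E₂ ℬ₂))
    (hconn₁ : MatroidConnected (toSubtypePred E₁ ℬ₁))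
    (hconn₂ : MatroidConnected (toSubtypePred E₂ ℬ₂))
    {a b c d : Fin n} (ha : a ∈ E₁) (hc : c ∈ E₁) (hb : b ∈ E₂) (hd : d ∈ E₂)
    (h1 : b < a) (h2 : a < d) (h3 : c < b ∨ d < c) : False := by
  have nd : ∀ x y, x ∈ E₁ → y ∈ E₂ → x ≠ y := by
    rintro x _ h h' rfl
    exact Finset.disjoint_left.1 hdisj h h'
  have hsum' : ∀ B, ℬ B ↔ ∃ B₁ B₂, ℬ₂ B₁ ∧ ℬ₁ B₂ ∧ B = B₁ ∪ B₂ := by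
    intro B
    rw [hsum]
    constructor
    · rintro ⟨X, Y, hX, hY, rfl⟩; exact ⟨Y, X, hY, hX, Finset.union_comm _ _⟩
    · rintro ⟨X, Y, hX, hY, rfl⟩; exact ⟨Y, X, hY, hX, Finset.union_comm _ _⟩
  obtain ⟨S, p, q, -, hp, hq, hPp, hPq, hpS, hqS, hpB, hqB⟩ :=
    cross_fin hpos₁ hconn₁ (fun x => b < x ∧ x < d) ha hc ⟨h1, h2⟩ (by
      rintro ⟨h4, h5⟩
      rcases h3 with h | h
      · exact absurd h (not_lt.2 h4.le)
      · exact absurd h (not_lt.2 h5.le))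
  -- normalise: an exchange pair lo < hi in E₁ separating b and d
  have main : ∀ lo hi : Fin n, lo ∈ E₁ → hi ∈ E₁ → lo ∉ S → hi ∉ S → ℬ₁ (insert lo S) →
      ℬ₁ (insert hi S) → ∀ x y, x ∈ E₂ → y ∈ E₂ → lo < x → x < hi → (y < lo ∨ hi < y) → False := by
    intro lo hi hlo hhi hloS hhiS hloB hhiB x y hx hy hlx hxh hyo
    obtain ⟨T, r, t, -, hr, ht, hPr, hPt, hrT, htT, hrB, htB⟩ :=
      cross_fin hpos₂ hconn₂ (fun z => lo < z ∧ z < hi) hx hy ⟨hlx, hxh⟩ (by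
        rintro ⟨h4, h5⟩
        rcases hyo with h | h
        · exact absurd h (not_lt.2 h4.le)
        · exact absurd h (not_lt.2 h5.le))
    have ht1 : t < lo ∨ hi < t := by
      rcases lt_or_gt_of_ne (nd lo t hlo ht) with h | h
      · right
        rcases lt_or_gt_of_ne (nd hi t hhi ht) with h' | h'
        · exact h'
        · exact absurd ⟨h, h'⟩ hPt
      · exact Or.inl h
    rcases ht1 with h | h
    · exact no_cross_sum hdisj.symm hsupp₂ hsupp₁ hsum' hpos T S htT hrT hloS hhiS htB hrB hloB hhiB
        h hPr.1 hPr.2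
    · exact no_cross_sum hdisj hsupp₁ hsupp₂ hsum hpos S T hloS hhiS hrT htT hloB hhiB hrB htB
        hPr.1 hPr.2 h
  have hq1 : q < b ∨ d < q := by
    rcases lt_or_gt_of_ne (nd q b hq hb) with h | h
    · exact Or.inl h
    · right
      rcases lt_or_gt_of_ne (nd q d hq hd) with h' | h'
      · exact absurd ⟨h, h'⟩ hPq
      · exact h'
  rcases hq1 with h | h
  · exact main q p hq hp hqS hpS hqB hpB b d hb hd h hPp.1 (Or.inr hPp.2)
  · exact main p q hp hq hpS hqS hpB hqB d b hd hb hPp.2 h (Or.inl hPp.1)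

lemma val_sub' {n : ℕ} (x y : Fin n) :
    (x - y).val = if y.val ≤ x.val then x.val - y.val else n + x.val - y.val := by
  have hx := x.2
  have hy := y.2
  rw [Fin.sub_def]
  simp only
  split_ifs with h
  · rw [show n - y.val + x.val = (x.val - y.val) + n by omega, Nat.add_mod_right]
    exact Nat.mod_eq_of_lt (by omega)
  · rw [show n - y.val + x.val = n + x.val - y.val by omega]
    exact Nat.mod_eq_of_lt (by omega)

lemma both_cyc {n : ℕ} {E F : Finset (Fin n)} (hE : E.Nonempty) (hF : F.Nonempty)
    (hdisj : Disjoint E F) (hunion : E ∪ F = Finset.univ)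
    (h : ∀ a b c d, a ∈ E → c ∈ E → b ∈ F → d ∈ F → b < a → a < d → (c < b ∨ d < c) → False)
    (h0 : ∃ z : Fin n, z.val = 0 ∧ z ∈ E) :
    (∃ i j : Fin n, E = cycInt i j) ∧ (∃ i j : Fin n, F = cycInt i j) := by
  obtain ⟨z, hz, hzE⟩ := h0
  have mem : ∀ x, x ∈ E ↔ x ∉ F := by
    intro x
    constructor
    · exact fun h h' => Finset.disjoint_left.1 hdisj h h'
    · intro hx
      have : x ∈ E ∪ F := by rw [hunion]; exact Finset.mem_univ x
      exact (Finset.mem_union.1 this).resolve_right hx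
  set p := F.min' hF with hp
  set q := F.max' hF with hq
  have hpF : p ∈ F := F.min'_mem hF
  have hqF : q ∈ F := F.max'_mem hF
  have hFI : ∀ x, x ∈ F ↔ p.val ≤ x.val ∧ x.val ≤ q.val := by
    intro x
    constructor
    · intro hx; exact ⟨F.min'_le x hx, F.le_max' x hx⟩
    · rintro ⟨h1, h2⟩
      by_contra hx
      have hxE := (mem x).2 hx
      have hxp : x ≠ p := by rintro rfl; exact hx hpF
      have hxq : x ≠ q := by rintro rfl; exact hx hqF
      have hzp : z ≠ p := by rintro h; exact (mem z).1 hzE (h ▸ hpF)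
      refine h x p z q hxE hzE hpF hqF (lt_of_le_of_ne h1 hxp.symm) (lt_of_le_of_ne h2 hxq)
        (Or.inl (lt_of_le_of_ne ?_ hzp))
      rw [Fin.le_def, hz]; omega
  have hp0 : 0 < p.val := by
    rcases Nat.eq_zero_or_pos p.val with h | h
    · exact absurd ((Fin.ext (by omega) : z = p) ▸ hpF) ((mem z).1 hzE)
    · exact h
  have hpq : p.val ≤ q.val := F.min'_le q hqF
  have hpn := p.2
  have hqn := q.2
  refine ⟨?_, p, q, ?_⟩
  · by_cases hqe : q.val + 1 < n
    · refine ⟨⟨q.val + 1, hqe⟩, ⟨p.val - 1, by omega⟩, ?_⟩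
      ext x
      have hxn := x.2
      rw [mem, hFI, cycInt, Finset.mem_filter, val_sub', val_sub']
      simp only [Finset.mem_univ, true_and]
      split_ifs <;> omega
    · refine ⟨⟨0, by omega⟩, ⟨p.val - 1, by omega⟩, ?_⟩
      ext x
      have hxn := x.2
      rw [mem, hFI, cycInt, Finset.mem_filter, val_sub', val_sub']
      simp only [Finset.mem_univ, true_and]
      split_ifs <;> omega
  · ext x
    have hxn := x.2
    rw [hFI, cycInt, Finset.mem_filter, val_sub', val_sub']
    simp only [Finset.mem_univ, true_and]
    split_ifs <;> omega

end PosAux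

/-- Suppose `M` is a positroid on `[n]` which is the direct sum
`M₁ ⊕ M₂` of two connected positroids `M₁` and `M₂` on nonempty ground sets
`E₁` and `E₂` with `E₁ ∪ E₂ = [n]` and `E₁ ∩ E₂ = ∅` (each `Eᵢ` carrying the
order inherited from `[n]`).  Then `E₁` and `E₂` are cyclic intervals of `[n]`. -/
theorem components_are_cyclic_intervals (n : ℕ) (ℬ ℬ₁ ℬ₂ : Finset (Fin n) → Prop)
    (E₁ E₂ : Finset (Fin n))
    (hne₁ : E₁.Nonempty) (hne₂ : E₂.Nonempty)
    (hdisj : Disjoint E₁ E₂) (hunion : E₁ ∪ E₂ = Finset.univ)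
    (hsupp₁ : ∀ B, ℬ₁ B → B ⊆ E₁) (hsupp₂ : ∀ B, ℬ₂ B → B ⊆ E₂)
    (hsum : ∀ B, ℬ B ↔ ∃ B₁ B₂, ℬ₁ B₁ ∧ ℬ₂ B₂ ∧ B = B₁ ∪ B₂)
    (hpos : IsPositroid ℬ)
    (hpos₁ : IsPositroid (toSubtypePred E₁ ℬ₁)) (hpos₂ : IsPositroid (toSubtypePred E₂ ℬ₂))
    (hconn₁ : MatroidConnected (toSubtypePred E₁ ℬ₁))
    (hconn₂ : MatroidConnected (toSubtypePred E₂ ℬ₂)) :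
    (∃ i j : Fin n, E₁ = cycInt i j) ∧ (∃ i j : Fin n, E₂ = cycInt i j) := by

  obtain ⟨x, hx⟩ := hne₁
  have hn : 0 < n := lt_of_le_of_lt (Nat.zero_le _) x.2
  have hsum' : ∀ B, ℬ B ↔ ∃ B₁ B₂, ℬ₂ B₁ ∧ ℬ₁ B₂ ∧ B = B₁ ∪ B₂ := by
    intro B
    rw [hsum]
    constructor
    · rintro ⟨X, Y, hX, hY, rfl⟩; exact ⟨Y, X, hY, hX, Finset.union_comm _ _⟩
    · rintro ⟨X, Y, hX, hY, rfl⟩; exact ⟨Y, X, hY, hX, Finset.union_comm _ _⟩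
  have h0 : (⟨0, hn⟩ : Fin n) ∈ E₁ ∪ E₂ := by rw [hunion]; exact Finset.mem_univ _
  rcases Finset.mem_union.1 h0 with h | h
  · exact PosAux.both_cyc ⟨x, hx⟩ hne₂ hdisj hunion
      (fun a b c d ha hc hb hd => PosAux.no_alt hdisj hsupp₁ hsupp₂ hsum hpos hpos₁ hpos₂ hconn₁
        hconn₂ ha hc hb hd) ⟨_, rfl, h⟩
  · exact (PosAux.both_cyc hne₂ ⟨x, hx⟩ hdisj.symm (by rw [Finset.union_comm]; exact hunion)
      (fun a b c d ha hc hb hd => PosAux.no_alt hdisj.symm hsupp₂ hsupp₁ hsum' hpos hpos₂ hpos₁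
        hconn₂ hconn₁ ha hc hb hd) ⟨_, rfl, h⟩).symm
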